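/- For every rooted digraph D = (V+r, E), the maximum number of edges of a subflame of D equals Σ_{v ∈ V} λ_D(r,v). -/

import Mathlib

/- Common setup: a rooted digraph `D = (V+r, E)` is modelled as a finite
vertex type `α` (whose elements are `V ∪ {r}`), a finite edge type `E`
(allowing parallel edges, i.e. a multigraph) and maps `tail head : E → α`.
Subgraphs / edge subsets are sets `F : Set E`; the whole digraph `D`
corresponds to the edge set `Set.univ`.  "`v ∈ V`" is rendered as `v ≠ r`,
and a vertex subset `X ⊆ V` as `X : Set α` with `r ∉ X`. -/

/-- In-degree of the vertex `v` in the digraph with edge set `F`. -/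
noncomputable def inDeg {α E : Type*} (head : E → α) (F : Set E) (v : α) : ℕ :=
  {e ∈ F | head e = v}.ncard

/-- `ϱ_F(X)`: the number of edges of `F` entering the vertex set `X`
(tail outside `X`, head in `X`). -/
noncomputable def rho {α E : Type*} (tail head : E → α) (F : Set E) (X : Set α) : ℕ :=
  {e ∈ F | tail e ∉ X ∧ head e ∈ X}.ncard

/-- `p` is a directed path from `r` to `v` using edges of `F`:
a nonempty list of consecutive edges, starting at `r`, ending at `v`, and
visiting pairwise distinct vertices. -/
def IsRVPath {α E : Type*} (tail head : E → α) (F : Set E) (r v : α) (p : List E) : Prop :=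
  (∀ e ∈ p, e ∈ F) ∧
  List.Chain' (fun e f => head e = tail f) p ∧
  (p.map tail).Nodup ∧ (∀ e ∈ p, tail e ≠ v) ∧
  (∃ e, p.head? = some e ∧ tail e = r) ∧
  (∃ e, p.getLast? = some e ∧ head e = v)

/-- There exist `n` pairwise edge-disjoint directed paths from `r` to `v`
in the edge set `F`. -/
def HasEDPaths {α E : Type*} (tail head : E → α) (F : Set E) (r v : α) (n : ℕ) : Prop :=
  ∃ P : Fin n → List E, (∀ i, IsRVPath tail head F r v (P i)) ∧
    ∀ i j, i ≠ j → ∀ e, e ∈ P i → e ∉ P j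

/-- `λ_F(r,v)`: the local edge-connectivity from `r` to `v`, i.e. the maximum
number of pairwise edge-disjoint directed paths from `r` to `v` in `F`. -/
noncomputable def lam {α E : Type*} (tail head : E → α) (F : Set E) (r v : α) : ℕ :=
  sSup {n | HasEDPaths tail head F r v n}

/-- `X` is a `v`-tight vertex set in the digraph with edge set `F` and root `r`:
`X ⊆ V` (i.e. `r ∉ X`), `v ∈ X` and `ϱ_F(X) = λ_F(r,v)`. -/
def Tight {α E : Type*} (tail head : E → α) (F : Set E) (r v : α) (X : Set α) : Prop :=
  v ∈ X ∧ r ∉ X ∧ rho tail head F X = lam tail head F r v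

/-- The digraph with edge set `F` is a flame with root `r`:
`λ_F(r,v) = ϱ_F(v)` for every `v ∈ V`. -/
def IsFlame {α E : Type*} (tail head : E → α) (F : Set E) (r : α) : Prop :=
  ∀ v, v ≠ r → lam tail head F r v = inDeg head F v

/-- `F` is a maximal flame within the ambient edge set `A`:
`λ_A(r,v) = λ_F(r,v) = ϱ_F(v)` for every `v ∈ V`. -/
def IsMaxFlameIn {α E : Type*} (tail head : E → α) (A : Set E) (r : α) (F : Set E) : Prop :=
  F ⊆ A ∧ ∀ v, v ≠ r →
    lam tail head A r v = lam tail head F r v ∧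
    lam tail head F r v = inDeg head F v

/-- A closed directed walk in `F` with pairwise distinct edges.  (If every
vertex is entered by at most one edge of `F`, the existence of such a walk is
equivalent to the existence of an undirected cycle in `F`.) -/
def IsDicycle {α E : Type*} (tail head : E → α) (F : Set E) (p : List E) : Prop :=
  p.Nodup ∧ (∀ e ∈ p, e ∈ F) ∧
  List.Chain' (fun e f => head e = tail f) p ∧
  (∃ e f, p.head? = some e ∧ p.getLast? = some f ∧ head f = tail e)

/-- `B` is a branching: every vertex is entered by at most one edge of `B` and,
disregarding edge directions, `B` contains no cycle (under the in-degree
condition this is equivalent to containing no directed cycle). -/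
def IsBranching {α E : Type*} (tail head : E → α) (B : Set E) : Prop :=
  (∀ v, inDeg head B v ≤ 1) ∧ ∀ p : List E, ¬ IsDicycle tail head B p

/-- The head-set of an edge set `B`: the vertices entered by an edge of `B`. -/
def headSet {α E : Type*} (head : E → α) (B : Set E) : Set α := {v | ∃ e ∈ B, head e = v}

/-- Independence in the gammoid `G_D(v)` (with `D` the whole digraph, edge set
`Set.univ`): `X ⊆ in_D(v)` is independent if there are `|X|` pairwise
edge-disjoint directed paths from `r` to `v` in `D` whose set of last edges is
exactly `X`. -/
def GammoidIndep {α E : Type*} (tail head : E → α) (r v : α) (X : Set E) : Prop :=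
  ∃ P : Fin X.ncard → List E,
    (∀ i, IsRVPath tail head Set.univ r v (P i)) ∧
    (∀ i j, i ≠ j → ∀ e, e ∈ P i → e ∉ P j) ∧
    (∀ e, e ∈ X ↔ ∃ i, (P i).getLast? = some e)

open Classical in
lemma rho_eq_sum {α E : Type*} [Fintype E] (tail head : E → α) (F : Set E) (X : Set α) :
    rho tail head F X = ∑ e, if e ∈ F ∧ tail e ∉ X ∧ head e ∈ X then 1 else 0 := by
  rw [rho, Set.ncard_eq_toFinset_card', ← Finset.card_filter]
  congr 1
  ext e
  simp
  tauto

lemma rho_inter_add_rho_union_le {α E : Type*} [Fintype E] (tail head : E → α) (F : Set E)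
    (X Y : Set α) :
    rho tail head F (X ∩ Y) + rho tail head F (X ∪ Y) ≤
      rho tail head F X + rho tail head F Y := by
  classical
  simp only [rho_eq_sum, ← Finset.sum_add_distrib]
  refine Finset.sum_le_sum fun e _ => ?_
  simp only [Set.mem_inter_iff, Set.mem_union]
  by_cases h1 : tail e ∈ X <;> by_cases h2 : tail e ∈ Y <;> by_cases h3 : head e ∈ X <;>
    by_cases h4 : head e ∈ Y <;> by_cases h5 : e ∈ F <;> simp [*]

lemma rho_le_rho_diff_singleton_add_one {α E : Type*} [Fintype E] (tail head : E → α)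
    (F : Set E) (X : Set α) (e : E) :
    rho tail head F X ≤ rho tail head (F \ {e}) X + 1 := by
  refine (Set.ncard_le_ncard (t := insert e {f ∈ F \ {e} | tail f ∉ X ∧ head f ∈ X})
    (fun f hf => ?_) (Set.toFinite _)).trans (Set.ncard_insert_le _ _)
  by_cases h : f = e
  · exact Or.inl h
  · exact Or.inr ⟨⟨hf.1, h⟩, hf.2⟩

lemma rho_diff_singleton_of_not_enters {α E : Type*} (tail head : E → α)
    (F : Set E) (X : Set α) (e : E) (he : ¬ (tail e ∉ X ∧ head e ∈ X)) :
    rho tail head (F \ {e}) X = rho tail head F X := by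
  unfold rho
  congr 1
  ext f
  simp only [Set.mem_sdiff, Set.mem_singleton_iff, Set.mem_ofPred_eq]
  constructor
  · exact fun h => ⟨h.1.1, h.2⟩
  · exact fun h => ⟨⟨h.1, fun hf => he (hf ▸ h.2)⟩, h.2⟩

/-- An edge set meeting lower bounds on the in-degrees of vertex sets contains a minimal such
edge set, and there every edge enters a set whose bound is attained. -/
lemma exists_minimal_cover {α E : Type*} [Fintype E] (tail head : E → α) (F : Set E)
    (req : Set α → ℕ → Prop) (hF : ∀ X n, req X n → n ≤ rho tail head F X) :
    ∃ G ⊆ F, (∀ X n, req X n → n ≤ rho tail head G X) ∧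
      ∀ e ∈ G, ∃ X, req X (rho tail head G X) ∧ tail e ∉ X ∧ head e ∈ X := by
  obtain ⟨G, hGF, hG⟩ := (Set.toFinite
    {G : Set E | ∀ X n, req X n → n ≤ rho tail head G X}).exists_le_minimal hF
  refine ⟨G, hGF, hG.prop, fun e he => ?_⟩
  by_contra! hcon
  have hmem : ∀ X n, req X n → n ≤ rho tail head (G \ {e}) X := by
    intro X n hreq
    have h := hG.prop X n hreq
    by_cases hent : tail e ∉ X ∧ head e ∈ X
    · have h1 := rho_le_rho_diff_singleton_add_one tail head G X e
      have h2 : n ≠ rho tail head G X := by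
        rintro rfl
        exact hcon X hreq hent.1 hent.2
      omega
    · rwa [rho_diff_singleton_of_not_enters tail head G X e hent]
  exact (hG.le_of_le hmem Set.sdiff_subset he).2 rfl

open Classical in
/-- The number of edges of `F` entering `X` minus the number of edges of `F` leaving `X`. -/
noncomputable def netIn {α E : Type*} [Fintype E] (tail head : E → α) (F : Set E) (X : Set α) :
    ℤ :=
  ∑ e, if e ∈ F then (if head e ∈ X then 1 else 0) - (if tail e ∈ X then 1 else 0) else 0

lemma netIn_le_rho {α E : Type*} [Fintype E] (tail head : E → α) (F : Set E) (X : Set α) :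
    netIn tail head F X ≤ rho tail head F X := by
  classical
  rw [netIn, rho_eq_sum]
  push_cast
  refine Finset.sum_le_sum fun e _ => ?_
  by_cases h1 : tail e ∈ X <;> by_cases h3 : head e ∈ X <;> by_cases h5 : e ∈ F <;> simp [*]

lemma netIn_diff {α E : Type*} [Fintype E] (tail head : E → α) {F G : Set E} (h : G ⊆ F)
    (X : Set α) :
    netIn tail head (F \ G) X = netIn tail head F X - netIn tail head G X := by
  classical
  simp only [netIn, ← Finset.sum_sub_distrib]
  refine Finset.sum_congr rfl fun e _ => ?_
  have := @h e
  by_cases h1 : e ∈ F <;> by_cases h2 : e ∈ G <;> simp_all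

open Classical in
lemma netIn_eq_sum {α E : Type*} [Fintype α] [Fintype E] (tail head : E → α) (F : Set E)
    (X : Set α) :
    netIn tail head F X = ∑ u with u ∈ X, netIn tail head F {u} := by
  simp only [netIn]
  rw [Finset.sum_comm]
  refine Finset.sum_congr rfl fun e _ => ?_
  by_cases h : e ∈ F <;> simp [h, Finset.sum_ite_eq]

open Classical in
lemma sum_map_of_chain {α E : Type*} (tail head : E → α) (X : Set α) (a b : α) (p : List E)
    (hc : List.IsChain (fun e f => head e = tail f) p)
    (ha : ∃ e, p.head? = some e ∧ tail e = a) (hb : ∃ e, p.getLast? = some e ∧ head e = b) :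
    (p.map fun e => ((if head e ∈ X then 1 else 0) - (if tail e ∈ X then 1 else 0) : ℤ)).sum =
      (if b ∈ X then 1 else 0) - (if a ∈ X then 1 else 0) := by
  induction p generalizing a with
  | nil => simp at ha
  | cons e p ih =>
    cases p with
    | nil => simp_all
    | cons f p =>
      rw [List.isChain_cons_cons] at hc
      have := ih (head e) hc.2 ⟨f, rfl, hc.1.symm⟩ (by simpa using hb)
      have ha : tail e = a := by simpa using ha
      rw [List.map_cons, List.sum_cons, this, ha]
      ring

lemma IsRVPath.nodup {α E : Type*} {tail head : E → α} {F : Set E} {r v : α} {p : List E}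
    (h : IsRVPath tail head F r v p) : p.Nodup :=
  List.Nodup.of_map _ h.2.2.1

lemma IsRVPath.mono {α E : Type*} {tail head : E → α} {F G : Set E} {r v : α} {p : List E}
    (h : IsRVPath tail head F r v p) (hFG : F ⊆ G) : IsRVPath tail head G r v p :=
  ⟨fun e he => hFG (h.1 e he), h.2⟩

lemma HasEDPaths.mono {α E : Type*} {tail head : E → α} {F G : Set E} {r v : α} {n : ℕ}
    (h : HasEDPaths tail head F r v n) (hFG : F ⊆ G) : HasEDPaths tail head G r v n := by
  obtain ⟨P, hP, hd⟩ := h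
  exact ⟨P, fun i => (hP i).mono hFG, hd⟩

lemma IsRVPath.netIn_eq_one {α E : Type*} [Fintype E] {tail head : E → α} {F : Set E} {r v : α}
    {p : List E} (h : IsRVPath tail head F r v p) {X : Set α} (hv : v ∈ X) (hr : r ∉ X) :
    netIn tail head {e | e ∈ p} X = 1 := by
  classical
  have h1 := sum_map_of_chain tail head X r v p h.2.1 h.2.2.2.2.1 h.2.2.2.2.2
  rw [← List.sum_toFinset _ h.nodup] at h1
  simp only [hv, hr, if_true, if_false, sub_zero] at h1
  rw [← h1, netIn]
  simp only [← List.mem_toFinset, Set.mem_ofPred_eq, Finset.sum_ite_mem, Finset.univ_inter]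

lemma IsRVPath.exists_enters {α E : Type*} [Fintype E] {tail head : E → α} {F : Set E} {r v : α}
    {p : List E} (h : IsRVPath tail head F r v p) {X : Set α} (hv : v ∈ X) (hr : r ∉ X) :
    ∃ e ∈ p, tail e ∉ X ∧ head e ∈ X := by
  have h1 := netIn_le_rho tail head {e | e ∈ p} X
  rw [h.netIn_eq_one hv hr] at h1
  have h2 : rho tail head {e | e ∈ p} X ≠ 0 := by omega
  exact Set.nonempty_of_ncard_ne_zero h2

lemma HasEDPaths.le_rho {α E : Type*} [Fintype E] {tail head : E → α} {F : Set E} {r v : α}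
    {n : ℕ} (h : HasEDPaths tail head F r v n) {X : Set α} (hv : v ∈ X) (hr : r ∉ X) :
    n ≤ rho tail head F X := by
  obtain ⟨P, hP, hd⟩ := h
  choose f hf using fun i => (hP i).exists_enters hv hr
  have hinj : Function.Injective f := by
    intro i j hij
    by_contra hne
    exact hd i j hne (f i) (hf i).1 (hij ▸ (hf j).1)
  calc n = (Set.range f).ncard := by
        rw [← Set.image_univ, Set.ncard_image_of_injective _ hinj]; simp
    _ ≤ rho tail head F X := Set.ncard_le_ncard
        (Set.range_subset_iff.2 fun i => ⟨(hP i).1 _ (hf i).1, (hf i).2⟩) (Set.toFinite _)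

lemma hasEDPaths_zero {α E : Type*} (tail head : E → α) (F : Set E) (r v : α) :
    HasEDPaths tail head F r v 0 :=
  ⟨fun i => i.elim0, fun i => i.elim0, fun i => i.elim0⟩

lemma bddAbove_hasEDPaths {α E : Type*} [Fintype E] (tail head : E → α) (F : Set E) {r v : α}
    (hv : v ≠ r) : BddAbove {n | HasEDPaths tail head F r v n} :=
  ⟨rho tail head F {v}, fun _ hn => HasEDPaths.le_rho hn rfl hv.symm⟩

lemma hasEDPaths_lam {α E : Type*} [Fintype E] (tail head : E → α) (F : Set E) {r v : α}
    (hv : v ≠ r) : HasEDPaths tail head F r v (lam tail head F r v) :=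
  Nat.sSup_mem ⟨0, hasEDPaths_zero tail head F r v⟩ (bddAbove_hasEDPaths tail head F hv)

lemma HasEDPaths.le_lam {α E : Type*} [Fintype E] {tail head : E → α} {F : Set E} {r v : α}
    {n : ℕ} (h : HasEDPaths tail head F r v n) (hv : v ≠ r) : n ≤ lam tail head F r v :=
  le_csSup (bddAbove_hasEDPaths tail head F hv) h

lemma lam_le_rho {α E : Type*} [Fintype E] (tail head : E → α) (F : Set E) {r v : α}
    {X : Set α} (hv : v ∈ X) (hr : r ∉ X) : lam tail head F r v ≤ rho tail head F X :=
  (hasEDPaths_lam tail head F (ne_of_mem_of_not_mem hv hr)).le_rho hv hr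

lemma lam_mono {α E : Type*} [Fintype E] (tail head : E → α) {F G : Set E} (h : F ⊆ G)
    {r v : α} (hv : v ≠ r) : lam tail head F r v ≤ lam tail head G r v :=
  ((hasEDPaths_lam tail head F hv).mono h).le_lam hv

lemma exists_isRVPath_step {α E : Type*} {tail head : E → α} {F : Set E} {r : α} {e : E}
    (he : e ∈ F) (ht : tail e = r ∨ ∃ p, IsRVPath tail head F r (tail e) p) :
    head e = r ∨ ∃ p, IsRVPath tail head F r (head e) p := by
  by_cases hb : head e = r
  · exact Or.inl hb
  by_cases hloop : tail e = head e
  · rwa [hloop] at ht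
  right
  rcases ht with ht | ⟨p, hpF, hpc, hpn, hpv, ⟨a, ha, har⟩, ⟨z, hz, hze⟩⟩
  · exact ⟨[e], by simp [he], List.isChain_singleton _, by simp, by simp [hloop],
      ⟨e, rfl, ht⟩, ⟨e, rfl, rfl⟩⟩
  by_cases hmem : ∃ f ∈ p, tail f = head e
  · obtain ⟨f, hf, hfe⟩ := hmem
    obtain ⟨s, t, rfl⟩ := List.append_of_mem hf
    have hs : s ≠ [] := by
      rintro rfl
      simp only [List.nil_append, List.head?_cons, Option.some.injEq] at ha
      exact hb (hfe ▸ ha ▸ har)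
    rw [List.map_append, List.nodup_append] at hpn
    have hc := List.isChain_append.1 hpc
    refine ⟨s, fun x hx => hpF x (by simp [hx]), hc.1, hpn.1, fun x hx => ?_,
      ⟨a, ?_, har⟩, ⟨s.getLast hs, List.getLast?_eq_some_getLast hs, ?_⟩⟩
    · rw [← hfe]
      exact hpn.2.2 _ (List.mem_map_of_mem hx) _ (by simp)
    · rwa [List.head?_append_of_ne_nil _ hs] at ha
    · rw [← hfe]
      exact hc.2.2 _ (List.getLast?_eq_some_getLast hs) f rfl
  · push Not at hmem
    refine ⟨p ++ [e], ?_, ?_, ?_, ?_, ⟨a, ?_, har⟩, ⟨e, by simp, rfl⟩⟩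
    · intro x hx
      rcases List.mem_append.1 hx with hx | hx
      · exact hpF x hx
      · rwa [List.mem_singleton.1 hx]
    · refine List.isChain_append.2 ⟨hpc, List.isChain_singleton _, fun x hx y hy => ?_⟩
      simp_all
    · rw [List.map_append, List.nodup_append]
      refine ⟨hpn, by simp, fun x hx y hy => ?_⟩
      obtain ⟨f, hf, rfl⟩ := List.mem_map.1 hx
      obtain rfl : y = tail e := by simpa using hy
      exact hpv f hf
    · intro x hx
      rcases List.mem_append.1 hx with hx | hx
      · exact hmem x hx
      · rwa [List.mem_singleton.1 hx]
    · simp [ha]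

lemma exists_isRVPath {α E : Type*} {tail head : E → α} {F : Set E} {r v : α}
    (hv : v ≠ r) (h : ∀ X : Set α, v ∈ X → r ∉ X → 0 < rho tail head F X) :
    ∃ p, IsRVPath tail head F r v p := by
  by_contra hcon
  have hpos := h {u | ¬ (u = r ∨ ∃ p, IsRVPath tail head F r u p)} (fun h => h.elim hv hcon) (by simp)
  obtain ⟨e, heF, ht, hh⟩ := Set.nonempty_of_ncard_ne_zero hpos.ne'
  exact hh (exists_isRVPath_step heF (not_not.1 ht))

lemma hasEDPaths_of_le_netIn {α E : Type*} [Fintype E] {tail head : E → α} {r v : α}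
    (hv : v ≠ r) (k : ℕ) (F : Set E)
    (h : ∀ X : Set α, v ∈ X → r ∉ X → (k : ℤ) ≤ netIn tail head F X) :
    HasEDPaths tail head F r v k := by
  induction k generalizing F with
  | zero => exact hasEDPaths_zero tail head F r v
  | succ k ih =>
    obtain ⟨p, hp⟩ := exists_isRVPath (F := F) (tail := tail) (head := head) hv
      fun X hvX hrX => by
      have h1 := (h X hvX hrX).trans (netIn_le_rho tail head F X)
      push_cast at h1
      omega
    obtain ⟨P, hP, hd⟩ := ih (F \ {e | e ∈ p}) fun X hvX hrX => by
      have h1 := h X hvX hrX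
      rw [netIn_diff tail head (G := {e | e ∈ p}) (fun e he => hp.1 e he), hp.netIn_eq_one hvX hrX]
      push_cast at h1
      omega
    have hdis : ∀ i, ∀ e ∈ P i, e ∉ p := fun i e he => ((hP i).1 e he).2
    refine ⟨Fin.cons p P, fun i => ?_, fun i j => ?_⟩
    · refine Fin.cases ?_ (fun i => ?_) i
      · simpa using hp
      · simpa using (hP i).mono Set.sdiff_subset
    · refine Fin.cases ?_ (fun i => ?_) i <;> refine Fin.cases ?_ (fun j => ?_) j
      · simp
      · simpa using fun _ e he he' => hdis j e he' he
      · simpa using fun e he => hdis i e he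
      · simpa using hd i j

/-- The edge version of Menger's theorem for rooted digraphs. -/
lemma hasEDPaths_of_le_rho {α E : Type*} [Fintype α] [Fintype E] {tail head : E → α} {r v : α}
    (hv : v ≠ r) (k : ℕ) (F : Set E)
    (h : ∀ X : Set α, v ∈ X → r ∉ X → k ≤ rho tail head F X) :
    HasEDPaths tail head F r v k := by
  classical
  obtain ⟨G, hGF, hG, htight⟩ := exists_minimal_cover tail head F
    (fun X n => v ∈ X ∧ r ∉ X ∧ n = k) (by rintro X n ⟨h1, h2, rfl⟩; exact h X h1 h2)
  replace hG : ∀ X : Set α, v ∈ X → r ∉ X → k ≤ rho tail head G X :=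
    fun X h1 h2 => hG X k ⟨h1, h2, rfl⟩
  refine HasEDPaths.mono (hasEDPaths_of_le_netIn hv k G fun X hvX hrX => ?_) hGF
  have hnetv : (k : ℤ) ≤ netIn tail head G {v} := by
    have h1 : rho tail head G {v} = netIn tail head G {v} := by
      rw [netIn, rho_eq_sum]
      push_cast
      refine Finset.sum_congr rfl fun e _ => ?_
      by_cases he : e ∈ G
      · obtain ⟨Y, hY, ht, -⟩ := htight e he
        have : tail e ≠ v := fun h => ht (h ▸ hY.1)
        simp [he, this]
      · simp [he]
    rw [← h1]
    exact_mod_cast hG {v} rfl hv.symm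
  have hnet : ∀ u, u ≠ r → u ≠ v → 0 ≤ netIn tail head G {u} := by
    intro u hur huv
    by_cases hout : ∃ e ∈ G, tail e = u
    · obtain ⟨e, he, heu⟩ := hout
      obtain ⟨Y, ⟨hvY, hrY, hY⟩, htY, -⟩ := htight e he
      obtain ⟨M, -, hM⟩ := (Set.toFinite {X : Set α | v ∈ X ∧ r ∉ X ∧
        rho tail head G X = k ∧ u ∉ X}).exists_le_maximal ⟨hvY, hrY, hY, heu ▸ htY⟩
      obtain ⟨hvM, hrM, hkM, huM⟩ := hM.prop
      have hout : ∀ f ∈ G, tail f = u → head f ∈ M := by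
        intro f hf hfu
        obtain ⟨Z, ⟨hvZ, hrZ, hZ⟩, htZ, hhZ⟩ := htight f hf
        have h1 := rho_inter_add_rho_union_le tail head G Z M
        have h2 := hG (Z ∩ M) ⟨hvZ, hvM⟩ fun h => hrZ h.1
        have h3 := hG (Z ∪ M) (Or.inl hvZ) fun h => h.elim hrZ hrM
        exact hM.le_of_ge (y := Z ∪ M) ⟨Or.inl hvZ, fun h => h.elim hrZ hrM, by omega,
          fun h => h.elim (hfu ▸ htZ) huM⟩ Set.subset_union_right (Or.inl hhZ)
      have h1 := hG (insert u M) (Or.inr hvM) fun h => h.elim hur.symm hrM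
      have h2 : (rho tail head G (insert u M) : ℤ) ≤ rho tail head G M + netIn tail head G {u} := by
        rw [netIn, rho_eq_sum, rho_eq_sum]
        push_cast
        rw [← Finset.sum_add_distrib]
        refine Finset.sum_le_sum fun f _ => ?_
        by_cases hf : f ∈ G
        · have := hout f hf
          by_cases htu : tail f = u
          · have hne : head f ≠ u := fun h => huM (h ▸ this htu)
            simp [hf, htu, huM, this htu, hne]
          · by_cases hhu : head f = u
            · by_cases htM : tail f ∈ M <;> simp [hf, htu, hhu, huM, htM]
            · simp [hf, htu, hhu]
        · simp [hf]
      omega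
    · push Not at hout
      refine Finset.sum_nonneg fun e _ => ?_
      by_cases he : e ∈ G
      · by_cases h : head e = u <;> simp [he, hout e he, h]
      · simp [he]
  rw [netIn_eq_sum]
  refine hnetv.trans (Finset.single_le_sum (f := fun u => netIn tail head G {u})
    (fun u hu => ?_) (by simpa using hvX))
  have huX : u ∈ X := by simpa using hu
  by_cases huv : u = v
  · subst huv
    exact (Int.natCast_nonneg k).trans hnetv
  · exact hnet u (ne_of_mem_of_not_mem huX hrX) huv

lemma exists_tight {α E : Type*} [Fintype α] [Fintype E] (tail head : E → α) (F : Set E)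
    {r v : α} (hv : v ≠ r) : ∃ X, Tight tail head F r v X := by
  by_contra! hcon
  have h := hasEDPaths_of_le_rho (tail := tail) (head := head) hv (lam tail head F r v + 1) F
    fun X hvX hrX => Nat.succ_le_of_lt <| lt_of_le_of_ne (lam_le_rho tail head F hvX hrX)
      fun h => hcon X ⟨hvX, hrX, h.symm⟩
  exact absurd (h.le_lam hv) (by omega)

lemma rho_singleton_le_inDeg {α E : Type*} [Fintype E] (tail head : E → α) (F : Set E) (v : α) :
    rho tail head F {v} ≤ inDeg head F v :=
  Set.ncard_le_ncard (fun _ he => ⟨he.1, he.2.2⟩) (Set.toFinite _)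

/-- Lovász's theorem: there is a flame preserving all local edge-connectivities from the root. -/
lemma exists_isMaxFlameIn {α E : Type*} [Fintype α] [Fintype E] (tail head : E → α) (A : Set E)
    (r : α) : ∃ F, IsMaxFlameIn tail head A r F := by
  obtain ⟨G, hGA, hG, htight⟩ := exists_minimal_cover tail head A
    (fun X n => r ∉ X ∧ ∃ w ∈ X, n = lam tail head A r w)
    (by rintro X n ⟨hr, w, hw, rfl⟩; exact lam_le_rho tail head A hw hr)
  have hlam : ∀ v, v ≠ r → lam tail head A r v = lam tail head G r v := fun v hv =>
    ((hasEDPaths_of_le_rho hv _ G fun X hvX hrX => hG X _ ⟨hrX, v, hvX, rfl⟩).le_lam hv).antisymm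
      (lam_mono tail head hGA hv)
  refine ⟨G, hGA, fun v hv => ⟨hlam v hv, le_antisymm
    ((lam_le_rho tail head G (Set.mem_singleton v) hv.symm).trans (rho_singleton_le_inDeg tail head G v)) ?_⟩⟩
  obtain ⟨Y₀, hY₀⟩ := exists_tight tail head G hv
  obtain ⟨Y, -, hY⟩ := (Set.toFinite {X | Tight tail head G r v X}).exists_le_minimal hY₀
  obtain ⟨hvY, hrY, hkY⟩ := hY.prop
  rw [← hkY]
  refine Set.ncard_le_ncard (fun e he => ?_) (Set.toFinite _)
  obtain ⟨heG, rfl⟩ := he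
  refine ⟨heG, fun htY => ?_, hvY⟩
  obtain ⟨X, ⟨hrX, w, hwX, hX⟩, htX, hhX⟩ := htight e heG
  have h1 := rho_inter_add_rho_union_le tail head G X Y
  have h2 := lam_le_rho tail head G (X := X ∩ Y) ⟨hhX, hvY⟩ fun h => hrX h.1
  have h3 := hG (X ∪ Y) _ ⟨fun h => h.elim hrX hrY, w, Or.inl hwX, rfl⟩
  exact htX (hY.le_of_le (y := X ∩ Y) ⟨⟨hhX, hvY⟩, fun h => hrX h.1, by omega⟩
    Set.inter_subset_right htY).1

lemma ncard_eq_sum_inDeg {α E : Type*} [Fintype α] [Fintype E] [DecidableEq α] {head : E → α}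
    {r : α} (hr : ∀ e : E, head e ≠ r) (F : Set E) :
    F.ncard = ∑ v ∈ Finset.univ.filter (fun v => v ≠ r), inDeg head F v := by
  classical
  rw [Set.ncard_eq_toFinset_card',
    Finset.card_eq_sum_card_fiberwise (f := head) (t := Finset.univ.filter (fun v => v ≠ r))
      (fun e _ => by simp [hr])]
  refine Finset.sum_congr rfl fun v _ => ?_
  rw [inDeg, Set.ncard_eq_toFinset_card']
  congr 1
  ext e
  simp

/-- the maximum number of edges of a subflame of `D` equals
`Σ_{v ∈ V} λ_D(r,v)`.  (As is implicit for rooted digraphs in this context,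
no edge of `D` enters the root `r`.) -/
theorem max_subflame_size
    {α E : Type*} [Fintype α] [Fintype E] [DecidableEq α]
    (tail head : E → α) (r : α) (hr : ∀ e : E, head e ≠ r) :
    IsGreatest {n : ℕ | ∃ F : Set E, IsFlame tail head F r ∧ F.ncard = n}
      (∑ v ∈ Finset.univ.filter (fun v => v ≠ r), lam tail head Set.univ r v) := by
  constructor
  · obtain ⟨F, -, hF⟩ := exists_isMaxFlameIn tail head Set.univ r
    refine ⟨F, fun v hv => (hF v hv).2, ?_⟩
    rw [ncard_eq_sum_inDeg hr]
    refine Finset.sum_congr rfl fun v hv => ?_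
    have hvr := (Finset.mem_filter.1 hv).2
    rw [(hF v hvr).1, (hF v hvr).2]
  · rintro n ⟨F, hF, rfl⟩
    rw [ncard_eq_sum_inDeg hr]
    refine Finset.sum_le_sum fun v hv => ?_
    have hvr := (Finset.mem_filter.1 hv).2
    rw [← hF v hvr]
    exact lam_mono tail head (Set.subset_univ F) hvr
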